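/- Let R be an associative ring with identity, n ≥ 0 an integer, and X an object of D(R). Then the following are equivalent: (i) X has ξ-projective dimension at most n, i.e., there exist objects X_0, …, X_n of D(R) with X_0 ≅ X, X_n ∈ ⟨P⟩₁, and for each 0 ≤ t ≤ n−1 a cohomologically ghost distinguished triangle X_{t+1} → P_t → X_t → X_{t+1}⟦1⟧ with P_t ∈ ⟨P⟩₁; (ii) for every s ∈ ℤ the module H^s(X) has projective dimension at most n, and for every left R-module B satisfying Ext^1_R(L,B)=0 for all modules L of projective dimension at most n, the canonical map γ_s : Hom_{D(R)}(X, S(B)⟦s⟧) → Hom_R(H^{-s}(X), B) is bijective for every s ∈ ℤ. (Proposition 3.9(5) combined with Lemma 2.1 for the complete hereditary cotorsion pair (P_n, P_n^⊥).) -/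

import Mathlib

open CategoryTheory Limits DerivedCategory Pretriangulated

noncomputable section

universe w u

variable {R : Type u} [Ring R]

def Ext1Zero [HasExt.{w} (ModuleCat.{u} R)] (A B : ModuleCat.{u} R) : Prop :=
  Subsingleton (Abelian.Ext A B 1)

def IsSES {K M N : ModuleCat.{u} R} (i : K ⟶ M) (p : M ⟶ N) : Prop :=
  Function.Injective i ∧ Function.Surjective p ∧ Function.Exact i p

variable [HasDerivedCategory.{w} (ModuleCat.{u} R)]

def GhostTriangle {X Y Z : DerivedCategory (ModuleCat.{u} R)}
    (f : X ⟶ Y) (g : Y ⟶ Z) (h : Z ⟶ X⟦(1:ℤ)⟧) : Prop :=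
  (Triangle.mk f g h ∈ distTriang (DerivedCategory (ModuleCat.{u} R))) ∧
  ∀ s : ℤ,
    Function.Injective ((homologyFunctor (ModuleCat.{u} R) s).map f) ∧
    Function.Surjective ((homologyFunctor (ModuleCat.{u} R) s).map g) ∧
    Function.Exact ((homologyFunctor (ModuleCat.{u} R) s).map f)
      ((homologyFunctor (ModuleCat.{u} R) s).map g)

def stalk (M : ModuleCat.{u} R) : DerivedCategory (ModuleCat.{u} R) :=
  DerivedCategory.Q.obj
    ((HomologicalComplex.single (ModuleCat.{u} R) (ComplexShape.up ℤ) 0).obj M)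

def stalkHomologyIso (M : ModuleCat.{u} R) :
    (homologyFunctor (ModuleCat.{u} R) 0).obj (stalk M) ≅ M :=
  (homologyFunctorFactors (ModuleCat.{u} R) 0).app _ ≪≫
    (HomologicalComplex.homologyFunctorSingleIso (ModuleCat.{u} R) (ComplexShape.up ℤ) 0).app M

def shiftHomologyIso (X : DerivedCategory (ModuleCat.{u} R)) (s a a' : ℤ) (h : s + a = a') :
    (homologyFunctor (ModuleCat.{u} R) a).obj (X⟦s⟧) ≅
      (homologyFunctor (ModuleCat.{u} R) a').obj X :=
  ((homologyFunctor (ModuleCat.{u} R) 0).shiftIso s a a' h).app X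

def gammaMap (X : DerivedCategory (ModuleCat.{u} R)) (M : ModuleCat.{u} R) (s : ℤ)
    (f : X ⟶ (stalk M)⟦s⟧) : (homologyFunctor (ModuleCat.{u} R) (-s)).obj X ⟶ M :=
  (homologyFunctor (ModuleCat.{u} R) (-s)).map f ≫
    (shiftHomologyIso (stalk M) s (-s) 0 (by ring)).hom ≫ (stalkHomologyIso M).hom

def stalkCoproduct (J : Type u) (P : J → ModuleCat.{u} R) (n : J → ℤ) :
    DerivedCategory (ModuleCat.{u} R) :=
  DerivedCategory.Q.obj
    (∐ fun j => (((HomologicalComplex.single (ModuleCat.{u} R) (ComplexShape.up ℤ) 0).obj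
      (P j))⟦n j⟧))

def memP1 (E : DerivedCategory (ModuleCat.{u} R)) : Prop :=
  ∃ (J : Type u) (P : J → ModuleCat.{u} R) (n : J → ℤ),
    (∀ j, Projective (P j)) ∧
    ∃ (i : E ⟶ stalkCoproduct J P n) (r : stalkCoproduct J P n ⟶ E), i ≫ r = 𝟙 E

def pdLE : ℕ → ModuleCat.{u} R → Prop
  | 0, M => Projective M
  | n+1, M => ∃ (K P : ModuleCat.{u} R) (i : K ⟶ P) (p : P ⟶ M),
      Projective P ∧ IsSES i p ∧ pdLE n K

section ZeroDifferential

universe v u'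

variable {C : Type u'} [Category.{v} C] [Abelian C]

theorem exact_toCycles_homologyπ (L : CochainComplex C ℤ) (i j : ℤ) (hij : i + 1 = j) :
    (ShortComplex.mk (L.toCycles i j) (L.homologyπ j) (by simp)).Exact :=
  ShortComplex.exact_of_g_is_cokernel _ (L.homologyIsCokernel i j (by simp [← hij]))

/-- A map out of a complex of projectives with zero differential is null-homotopic as soon as
it is zero in homology. -/
theorem homotopy_zero_of_homologyMap_eq_zero {K L : CochainComplex C ℤ}
    (hd : ∀ i j, K.d i j = 0) [∀ i, Projective (K.X i)] (f : K ⟶ L)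
    (hf : ∀ i, HomologicalComplex.homologyMap f i = 0) : Nonempty (Homotopy f 0) := by
  have key : ∀ i j : ℤ, (ComplexShape.up ℤ).Rel j i →
      ∃ h : K.X i ⟶ L.X j, h ≫ L.d j i = f.f i := by
    intro i j hij
    let c : K.X i ⟶ K.cycles i := K.liftCycles (𝟙 _) (i + 1) (by simp) (by simp [hd])
    have hc : (c ≫ HomologicalComplex.cyclesMap f i) ≫ L.homologyπ i = 0 := by
      rw [Category.assoc, ← HomologicalComplex.homologyπ_naturality, hf, comp_zero, comp_zero]
    refine ⟨(exact_toCycles_homologyπ L j i hij).liftFromProjective _ hc, ?_⟩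
    have := (exact_toCycles_homologyπ L j i hij).liftFromProjective_comp _ hc
    have := this =≫ L.iCycles i
    simpa [c] using this
  choose h hh using key
  refine ⟨(Homotopy.ofEq ?_).trans (Homotopy.nullHomotopy' h)⟩
  ext i
  rw [Homotopy.nullHomotopicMap'_f (k₂ := i - 1) (k₁ := i) (k₀ := i + 1) (by simp) (by simp)]
  simp [hd, hh]

theorem isKProjective_of_d_eq_zero {K : CochainComplex C ℤ}
    (hd : ∀ i j, K.d i j = 0) [∀ i, Projective (K.X i)] : K.IsKProjective where
  nonempty_homotopy_zero f hL :=
    homotopy_zero_of_homologyMap_eq_zero hd f fun i =>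
      ((HomologicalComplex.exactAt_iff_isZero_homology _ _).1 (hL i)).eq_of_tgt _ _

/-- Any family of maps in homology out of a complex of projectives with zero differential is
induced by a chain map. -/
theorem exists_homologyMap_eq {K L : CochainComplex C ℤ}
    (hd : ∀ i j, K.d i j = 0) [∀ i, Projective (K.X i)]
    (φ : ∀ i, K.homology i ⟶ L.homology i) :
    ∃ f : K ⟶ L, ∀ i, HomologicalComplex.homologyMap f i = φ i := by
  let c (i : ℤ) : K.X i ⟶ K.cycles i := K.liftCycles (𝟙 _) (i + 1) (by simp) (by simp [hd])
  let l (i : ℤ) : K.X i ⟶ L.cycles i :=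
    Projective.factorThru (c i ≫ K.homologyπ i ≫ φ i) (L.homologyπ i)
  have hl (i : ℤ) : l i ≫ L.homologyπ i = c i ≫ K.homologyπ i ≫ φ i :=
    Projective.factorThru_comp _ _
  have hc (i : ℤ) : K.iCycles i ≫ c i = 𝟙 _ := by
    rw [← cancel_mono (K.iCycles i)]
    simp [c]
  let f : K ⟶ L :=
    { f := fun i => l i ≫ L.iCycles i
      comm' := fun i j _ => by simp [hd] }
  refine ⟨f, fun i => ?_⟩
  rw [← cancel_epi (K.homologyπ i), HomologicalComplex.homologyπ_naturality]
  have : HomologicalComplex.cyclesMap f i = K.iCycles i ≫ l i := by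
    rw [← cancel_mono (L.iCycles i)]
    simp [f]
  rw [this, Category.assoc, hl, reassoc_of% (hc i)]

/-- The complex with given terms and zero differential. -/
@[simps]
def zeroDComplex (P : ℤ → C) : CochainComplex C ℤ where
  X := P
  d _ _ := 0

section Coproducts

universe t

variable {J : Type t} [HasColimitsOfShape (Discrete J) C]
  {F : J → CochainComplex C ℤ}

/-- The terms of a coproduct of complexes are coproducts of the terms. -/
def sigmaXIsColimit (F : J → CochainComplex C ℤ) (i : ℤ) :
    IsColimit (Cofan.mk ((∐ F).X i) fun j => (Sigma.ι F j).f i) :=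
  isColimitCofanMkObjOfIsColimit (HomologicalComplex.eval _ (ComplexShape.up ℤ) i) _ _
    (coproductIsCoproduct F)

theorem sigma_X_hom_ext {i : ℤ} {A : C} {f g : (∐ F).X i ⟶ A}
    (h : ∀ j, (Sigma.ι F j).f i ≫ f = (Sigma.ι F j).f i ≫ g) : f = g :=
  (sigmaXIsColimit F i).hom_ext fun ⟨j⟩ => h j

theorem sigma_d_eq_zero (hF : ∀ j i k, (F j).d i k = 0) (i k : ℤ) : (∐ F).d i k = 0 :=
  sigma_X_hom_ext fun j => by simp [hF]

theorem projective_sigma_X (hF : ∀ j i, Projective ((F j).X i)) (i : ℤ) :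
    Projective ((∐ F).X i) := by
  have := fun j => hF j i
  refine ⟨fun f g _ => ⟨Cofan.IsColimit.desc (sigmaXIsColimit F i)
    fun j => Projective.factorThru ((Sigma.ι F j).f i ≫ f) g, sigma_X_hom_ext fun j => ?_⟩⟩
  have := Cofan.IsColimit.fac_assoc (sigmaXIsColimit F i)
    (fun j => Projective.factorThru ((Sigma.ι F j).f i ≫ f) g) j g
  exact this.trans (Projective.factorThru_comp _ _)

open Classical in
theorem nonempty_retract_zeroDComplex (hF : ∀ j i k, (F j).d i k = 0) (P : ℤ → C)
    (σ : ℤ → J) (e : ∀ i, (F (σ i)).X i ≅ P i) :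
    Nonempty (Retract (zeroDComplex P) (∐ F)) := by
  have hd := sigma_d_eq_zero hF
  let a : zeroDComplex P ⟶ ∐ F :=
    { f := fun i => (e i).inv ≫ (Sigma.ι F (σ i)).f i
      comm' := fun i k _ => by
        rw [hd, comp_zero]
        exact zero_comp.symm }
  let b (j : J) : F j ⟶ zeroDComplex P :=
    { f := fun i => if h : σ i = j then eqToHom (by rw [h]) ≫ (e i).hom else 0
      comm' := fun i k _ => by
        rw [hF, zero_comp]
        exact comp_zero }
  have hb (i : ℤ) : (b (σ i)).f i = (e i).hom := by
    dsimp only [b]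
    rw [dif_pos rfl, eqToHom_refl]
    exact Category.id_comp _
  refine ⟨⟨a, Limits.Sigma.desc b, ?_⟩⟩
  ext1 i
  have := congrArg (fun k => (e i).inv ≫ HomologicalComplex.Hom.f k i)
    (Limits.Sigma.ι_desc b (σ i))
  rw [hb, HomologicalComplex.comp_f] at this
  exact (Category.assoc _ _ _).trans (this.trans (e i).inv_hom_id)

end Coproducts

variable [HasDerivedCategory.{w} C]

theorem Q_map_surjective_of_isKProjective (K L : CochainComplex C ℤ) [K.IsKProjective]
    (f : Q.obj K ⟶ Q.obj L) : ∃ g : K ⟶ L, Q.map g = f := by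
  obtain ⟨g, hg⟩ := (CochainComplex.IsKProjective.Qh_map_bijective K
    ((HomotopyCategory.quotient _ _).obj L)).surjective
    ((quotientCompQhIso C).hom.app K ≫ f ≫ (quotientCompQhIso C).inv.app L)
  obtain ⟨g, rfl⟩ := (HomotopyCategory.quotient _ _).map_surjective g
  refine ⟨g, ?_⟩
  rw [← cancel_epi ((quotientCompQhIso C).hom.app K), ← quotientCompQhIso_hom_naturality, hg]
  simp

theorem Q_map_eq_zero_of_homotopy {K L : CochainComplex C ℤ} (f : K ⟶ L)
    (h : Homotopy f 0) : Q.map f = 0 := by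
  rw [← cancel_epi ((quotientCompQhIso C).hom.app K), ← quotientCompQhIso_hom_naturality,
    HomotopyCategory.eq_of_homotopy f 0 h]
  simp

/-- The homology of the image in the derived category of a cochain complex. -/
def homologyQIso (K : CochainComplex C ℤ) (i : ℤ) :
    (homologyFunctor C i).obj (Q.obj K) ≅ K.homology i :=
  (homologyFunctorFactors C i).app K

theorem homologyQIso_hom_naturality {K L : CochainComplex C ℤ} (f : K ⟶ L) (i : ℤ) :
    (homologyFunctor C i).map (Q.map f) ≫ (homologyQIso L i).hom =
      (homologyQIso K i).hom ≫ HomologicalComplex.homologyMap f i :=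
  homologyFunctorFactors_hom_naturality f i

/-- Morphisms from `E` in the derived category are the same as families of morphisms
in homology. -/
def IsHomologyFree (E : DerivedCategory C) : Prop :=
  ∀ X : DerivedCategory C, Function.Bijective
    (fun (f : E ⟶ X) (i : ℤ) => (homologyFunctor C i).map f)

theorem isHomologyFree_Q_obj {K : CochainComplex C ℤ}
    (hd : ∀ i j, K.d i j = 0) [∀ i, Projective (K.X i)] : IsHomologyFree (Q.obj K) := by
  have := isKProjective_of_d_eq_zero hd
  intro X
  let e := Q.objObjPreimageIso X
  constructor
  · intro f g hfg
    rw [← sub_eq_zero]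
    obtain ⟨k, hk⟩ := Q_map_surjective_of_isKProjective K _ ((f - g) ≫ e.inv)
    rw [← cancel_mono e.inv, ← hk, zero_comp]
    refine Q_map_eq_zero_of_homotopy k
      (homotopy_zero_of_homologyMap_eq_zero hd k fun i => ?_).some
    have h1 : (homologyFunctor C i).map (Q.map k) = 0 := by
      rw [hk, Functor.map_comp, Functor.map_sub, sub_eq_zero.2 (congr_fun hfg i), zero_comp]
    rw [← cancel_epi (homologyQIso K i).hom, ← homologyQIso_hom_naturality, h1, zero_comp,
      comp_zero]
  · intro φ
    obtain ⟨k, hk⟩ := exists_homologyMap_eq (L := Q.objPreimage X) hd fun i =>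
      (homologyQIso K i).inv ≫ φ i ≫ (homologyFunctor C i).map e.inv ≫ (homologyQIso _ i).hom
    refine ⟨Q.map k ≫ e.hom, funext fun i => ?_⟩
    dsimp only
    rw [← cancel_mono ((homologyFunctor C i).map e.inv), ← Functor.map_comp, Category.assoc,
      e.hom_inv_id, Category.comp_id, ← cancel_mono (homologyQIso _ i).hom,
      homologyQIso_hom_naturality, hk, Iso.hom_inv_id_assoc, Category.assoc]

theorem IsHomologyFree.of_retract {E F : DerivedCategory C} (hF : IsHomologyFree F)
    (i : E ⟶ F) (r : F ⟶ E) (h : i ≫ r = 𝟙 E) : IsHomologyFree E := by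
  intro X
  constructor
  · intro f g hfg
    have : r ≫ f = r ≫ g := (hF X).1 (funext fun s => by
      simpa using congrArg ((homologyFunctor C s).map r ≫ ·) (congr_fun hfg s))
    simpa [reassoc_of% h] using congrArg (i ≫ ·) this
  · intro φ
    obtain ⟨g, hg⟩ := (hF X).2 fun s => (homologyFunctor C s).map r ≫ φ s
    refine ⟨i ≫ g, funext fun s => ?_⟩
    have := congr_fun hg s
    dsimp only at this ⊢
    rw [Functor.map_comp, this, ← Functor.map_comp_assoc, h]
    simp

/-- The homology of a complex with zero differential. -/
def homologyIsoOfDEqZero {K : CochainComplex C ℤ} (hd : ∀ i j, K.d i j = 0) (i : ℤ) :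
    (homologyFunctor C i).obj (Q.obj K) ≅ K.X i :=
  haveI := K.isIso_iCycles i (i + 1) (by simp) (hd _ _)
  haveI := K.isIso_homologyπ (i - 1) i (by simp) (hd _ _)
  homologyQIso K i ≪≫ (asIso (K.homologyπ i)).symm ≪≫ asIso (K.iCycles i)

end ZeroDifferential

section Modules

variable {A : Type u} [Ring A]

theorem IsSES.shortExact {K M N : ModuleCat.{u} A} {i : K ⟶ M} {p : M ⟶ N} (h : IsSES i p) :
    ∃ w : i ≫ p = 0, (ShortComplex.mk i p w).ShortExact := by
  have w : i ≫ p = 0 := by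
    ext x
    exact h.2.2.apply_apply_eq_zero x
  refine ⟨w, { exact := ?_, mono_f := ?_, epi_g := ?_ }⟩
  · exact (ShortComplex.ShortExact.moduleCat_exact_iff_function_exact _).2 h.2.2
  · exact (ModuleCat.mono_iff_injective _).2 h.1
  · exact (ModuleCat.epi_iff_surjective _).2 h.2.1

theorem isSES_of_shortExact {S : ShortComplex (ModuleCat.{u} A)} (h : S.ShortExact) :
    IsSES S.f S.g :=
  ⟨(ModuleCat.mono_iff_injective _).1 h.mono_f, (ModuleCat.epi_iff_surjective _).1 h.epi_g,
    (ShortComplex.ShortExact.moduleCat_exact_iff_function_exact _).1 h.exact⟩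

theorem pdLE_iff_hasProjectiveDimensionLE (n : ℕ) (M : ModuleCat.{u} A) :
    pdLE n M ↔ HasProjectiveDimensionLE M n := by
  induction n generalizing M with
  | zero => exact projective_iff_hasProjectiveDimensionLE_zero M
  | succ n ih =>
    constructor
    · rintro ⟨K, P, i, p, hP, hip, hK⟩
      obtain ⟨w, hS⟩ := hip.shortExact
      exact (hS.hasProjectiveDimensionLT_X₃_iff n hP).2 ((ih K).1 hK)
    · intro hM
      have hS : (ShortComplex.mk (kernel.ι (Projective.π M)) (Projective.π M)
          (kernel.condition _)).ShortExact :=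
        { exact := ShortComplex.exact_of_f_is_kernel _ (kernelIsKernel _) }
      exact ⟨_, _, _, _, inferInstance, isSES_of_shortExact hS,
        (ih _).2 ((hS.hasProjectiveDimensionLT_X₃_iff n inferInstance).1 hM)⟩

theorem pdLE_succ_iff_of_isSES {K P M : ModuleCat.{u} A} {i : K ⟶ P} {p : P ⟶ M}
    (hP : Projective P) (h : IsSES i p) (n : ℕ) : pdLE (n + 1) M ↔ pdLE n K := by
  obtain ⟨w, hS⟩ := h.shortExact
  rw [pdLE_iff_hasProjectiveDimensionLE, pdLE_iff_hasProjectiveDimensionLE]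
  exact hS.hasProjectiveDimensionLT_X₃_iff n hP

theorem pdLE_of_iso {M N : ModuleCat.{u} A} (e : M ≅ N) {n : ℕ} (h : pdLE n M) : pdLE n N := by
  rw [pdLE_iff_hasProjectiveDimensionLE] at h ⊢
  exact hasProjectiveDimensionLT_of_iso e _

theorem pdLE_succ {M : ModuleCat.{u} A} {n : ℕ} (h : pdLE n M) : pdLE (n + 1) M := by
  rw [pdLE_iff_hasProjectiveDimensionLE] at h ⊢
  exact hasProjectiveDimensionLT_of_ge _ (n + 1) _ (by lia)

theorem IsSES.exists_extension [HasExt.{w} (ModuleCat.{u} A)] {K M L N : ModuleCat.{u} A}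
    {i : K ⟶ M} {p : M ⟶ L} (h : IsSES i p) (hN : Ext1Zero L N) (a : K ⟶ N) :
    ∃ b : M ⟶ N, i ≫ b = a := by
  obtain ⟨w, hS⟩ := h.shortExact
  have : Subsingleton (Abelian.Ext L N 1) := hN
  obtain ⟨b, hb⟩ := Abelian.Ext.contravariant_sequence_exact₁ hS N (Abelian.Ext.mk₀ a)
    (n₁ := 1) (by simp) (Subsingleton.elim _ _)
  obtain ⟨b, rfl⟩ := Abelian.Ext.addEquiv₀.symm.surjective b
  refine ⟨b, Abelian.Ext.addEquiv₀.symm.injective ?_⟩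
  simpa using hb

/-- The stalk complex of `P` in degree `-n`. -/
def shiftedStalk (P : ModuleCat.{u} A) (n : ℤ) : CochainComplex (ModuleCat.{u} A) ℤ :=
  ((HomologicalComplex.single (ModuleCat.{u} A) (ComplexShape.up ℤ) 0).obj P)⟦n⟧

theorem shiftedStalk_d (P : ModuleCat.{u} A) (n i j : ℤ) : (shiftedStalk P n).d i j = 0 := by
  dsimp only [shiftedStalk]
  rw [CochainComplex.shiftFunctor_obj_d', HomologicalComplex.single_obj_d]
  exact smul_zero n.negOnePow

/-- The nonzero term of a shifted stalk complex. -/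
def shiftedStalkXIso (P : ModuleCat.{u} A) (n i : ℤ) (h : i + n = 0) :
    (shiftedStalk P n).X i ≅ P :=
  HomologicalComplex.singleObjXIsoOfEq (ComplexShape.up ℤ) 0 P (i + n) h

theorem projective_shiftedStalk_X (P : ModuleCat.{u} A) [Projective P] (n i : ℤ) :
    Projective ((shiftedStalk P n).X i) := by
  by_cases h : i + n = 0
  · exact Projective.of_iso (shiftedStalkXIso P n i h).symm inferInstance
  · exact (HomologicalComplex.isZero_single_obj_X (ComplexShape.up ℤ) 0 P (i + n) h).projective

end Modules

theorem memP1.of_retract {E F : DerivedCategory (ModuleCat.{u} R)} (hF : memP1 F)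
    (a : E ⟶ F) (b : F ⟶ E) (h : a ≫ b = 𝟙 E) : memP1 E := by
  obtain ⟨J, P, n, hP, i, r, hir⟩ := hF
  exact ⟨J, P, n, hP, a ≫ i, r ≫ b, by simp [reassoc_of% hir, h]⟩

theorem memP1.of_iso {E F : DerivedCategory (ModuleCat.{u} R)} (hF : memP1 F)
    (e : E ≅ F) : memP1 E :=
  hF.of_retract e.hom e.inv e.hom_inv_id

theorem memP1.isHomologyFree {E : DerivedCategory (ModuleCat.{u} R)} (hE : memP1 E) :
    IsHomologyFree E := by
  obtain ⟨J, P, n, hP, i, r, hir⟩ := hE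
  have := fun j => projective_shiftedStalk_X (P j) (n j)
  have := projective_sigma_X (F := fun j => shiftedStalk (P j) (n j)) this
  have hd := sigma_d_eq_zero (F := fun j => shiftedStalk (P j) (n j))
    fun j => shiftedStalk_d (P j) (n j)
  have h : IsHomologyFree (Q.obj (∐ fun j => shiftedStalk (P j) (n j))) :=
    isHomologyFree_Q_obj hd
  exact h.of_retract i r hir

theorem memP1.projective_homology {E : DerivedCategory (ModuleCat.{u} R)} (hE : memP1 E) (s : ℤ) :
    Projective ((homologyFunctor (ModuleCat.{u} R) s).obj E) := by
  obtain ⟨J, P, n, hP, i, r, hir⟩ := hE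
  have := fun j => projective_shiftedStalk_X (P j) (n j)
  have hX := projective_sigma_X (F := fun j => shiftedStalk (P j) (n j)) this s
  have hd := sigma_d_eq_zero (F := fun j => shiftedStalk (P j) (n j))
    fun j => shiftedStalk_d (P j) (n j)
  have : Projective ((homologyFunctor (ModuleCat.{u} R) s).obj (stalkCoproduct J P n)) :=
    Projective.of_iso (homologyIsoOfDEqZero hd s).symm hX
  exact ((Retract.mk i r hir).map (homologyFunctor _ s)).projective

theorem memP1_Q_obj_zeroDComplex (P : ℤ → ModuleCat.{u} R) (hP : ∀ i, Projective (P i)) :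
    memP1 (Q.obj (zeroDComplex P)) := by
  obtain ⟨h⟩ := nonempty_retract_zeroDComplex
    (F := fun j : ULift.{u} ℤ => shiftedStalk (P j.down) (-j.down))
    (fun j => shiftedStalk_d (P j.down) (-j.down)) P ULift.up
    (fun i => shiftedStalkXIso (P i) (-i) i (by lia))
  have h' := h.map Q
  exact ⟨ULift.{u} ℤ, fun j => P j.down, fun j => -j.down, fun j => hP j.down,
    h'.i, h'.r, h'.retract⟩

/-- Any family of maps from projective modules to the homology of `X` is realised by a map
from an object of `memP1`. -/
theorem exists_memP1_hom (X : DerivedCategory (ModuleCat.{u} R)) (P : ℤ → ModuleCat.{u} R)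
    (hP : ∀ i, Projective (P i))
    (φ : ∀ i, P i ⟶ (homologyFunctor (ModuleCat.{u} R) i).obj X) :
    ∃ (E : DerivedCategory (ModuleCat.{u} R)) (_ : memP1 E) (g : E ⟶ X)
      (e : ∀ i, (homologyFunctor (ModuleCat.{u} R) i).obj E ≅ P i),
      ∀ i, (homologyFunctor (ModuleCat.{u} R) i).map g = (e i).hom ≫ φ i := by
  have hE := memP1_Q_obj_zeroDComplex P hP
  let e (i : ℤ) := homologyIsoOfDEqZero (K := zeroDComplex P) (fun _ _ => rfl) i
  obtain ⟨g, hg⟩ := (hE.isHomologyFree X).2 fun i => (e i).hom ≫ φ i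
  exact ⟨_, hE, g, e, fun i => congr_fun hg i⟩

theorem memP1_of_projective_homology {X : DerivedCategory (ModuleCat.{u} R)}
    (hX : ∀ s, Projective ((homologyFunctor (ModuleCat.{u} R) s).obj X)) : memP1 X := by
  obtain ⟨E, hE, g, e, hg⟩ := exists_memP1_hom X _ hX fun i => 𝟙 _
  have : IsIso g := by
    rw [DerivedCategory.isIso_iff]
    intro i
    rw [hg]
    infer_instance
  exact hE.of_iso (asIso g).symm

theorem ghostTriangle_of_epi {X Y Z : DerivedCategory (ModuleCat.{u} R)}
    (f : X ⟶ Y) (g : Y ⟶ Z) (h : Z ⟶ X⟦(1 : ℤ)⟧)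
    (hT : Triangle.mk f g h ∈ distTriang (DerivedCategory (ModuleCat.{u} R)))
    (hg : ∀ s, Epi ((homologyFunctor (ModuleCat.{u} R) s).map g)) : GhostTriangle f g h := by
  refine ⟨hT, fun s => ?_⟩
  have : Mono ((homologyFunctor (ModuleCat.{u} R) s).map f) :=
    (HomologySequence.mono_homologyMap_mor₁_iff _ hT (s - 1) s).2
      ((HomologySequence.epi_homologyMap_mor₂_iff _ hT (s - 1) s).1 (hg (s - 1)))
  exact isSES_of_shortExact
    { exact := HomologySequence.exact₂ _ hT s, mono_f := this, epi_g := hg s }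

theorem GhostTriangle.isSES {X Y Z : DerivedCategory (ModuleCat.{u} R)}
    {f : X ⟶ Y} {g : Y ⟶ Z} {h : Z ⟶ X⟦(1 : ℤ)⟧} (hT : GhostTriangle f g h) (s : ℤ) :
    IsSES ((homologyFunctor (ModuleCat.{u} R) s).map f)
      ((homologyFunctor (ModuleCat.{u} R) s).map g) :=
  hT.2 s

/-- The `ξ`-projective dimension being at most `n`, in recursive form. -/
def xiPdLE : ℕ → DerivedCategory (ModuleCat.{u} R) → Prop
  | 0, X => memP1 X
  | n + 1, X => ∃ (K E : DerivedCategory (ModuleCat.{u} R)) (_ : memP1 E)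
      (f : K ⟶ E) (g : E ⟶ X) (h : X ⟶ K⟦(1 : ℤ)⟧), GhostTriangle f g h ∧ xiPdLE n K

theorem xiPdLE_of_pdLE_homology (n : ℕ) (X : DerivedCategory (ModuleCat.{u} R))
    (hX : ∀ s, pdLE n ((homologyFunctor (ModuleCat.{u} R) s).obj X)) : xiPdLE n X := by
  induction n generalizing X with
  | zero => exact memP1_of_projective_homology hX
  | succ n ih =>
    obtain ⟨E, hE, g, e, hg⟩ := exists_memP1_hom X _ (fun _ => inferInstance)
      fun i => Projective.π ((homologyFunctor (ModuleCat.{u} R) i).obj X)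
    obtain ⟨K, f, h, hT⟩ := distinguished_cocone_triangle₁ g
    have hG := ghostTriangle_of_epi f g h hT fun s => by
      rw [hg]
      infer_instance
    exact ⟨K, E, hE, f, g, h, hG, ih K fun s =>
      (pdLE_succ_iff_of_isSES (hE.projective_homology s) (hG.isSES s) n).1 (hX s)⟩

theorem pdLE_homology_of_xiPdLE (n : ℕ) (X : DerivedCategory (ModuleCat.{u} R))
    (hX : xiPdLE n X) (s : ℤ) : pdLE n ((homologyFunctor (ModuleCat.{u} R) s).obj X) := by
  induction n generalizing X with
  | zero => exact memP1.projective_homology hX s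
  | succ n ih =>
    obtain ⟨K, E, hE, f, g, h, hG, hK⟩ := hX
    exact (pdLE_succ_iff_of_isSES (hE.projective_homology s) (hG.isSES s) n).2 (ih K hK)

theorem xiPdLE_of_iso {n : ℕ} {X Y : DerivedCategory (ModuleCat.{u} R)} (e : X ≅ Y)
    (hX : xiPdLE n X) : xiPdLE n Y :=
  xiPdLE_of_pdLE_homology n Y fun s =>
    pdLE_of_iso ((homologyFunctor _ s).mapIso e) (pdLE_homology_of_xiPdLE n X hX s)

theorem xiPdLE_iff_exists_sequence (n : ℕ) (X : DerivedCategory (ModuleCat.{u} R)) :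
    xiPdLE n X ↔ ∃ Xs : ℕ → DerivedCategory (ModuleCat.{u} R),
      Nonempty (Xs 0 ≅ X) ∧ memP1 (Xs n) ∧
      ∀ t : ℕ, t < n → ∃ (Pt : DerivedCategory (ModuleCat.{u} R)) (_ : memP1 Pt)
        (f : Xs (t+1) ⟶ Pt) (g : Pt ⟶ Xs t) (h : Xs t ⟶ (Xs (t+1))⟦(1:ℤ)⟧),
        GhostTriangle f g h := by
  constructor
  · suffices h : xiPdLE n X → ∃ Xs : ℕ → DerivedCategory (ModuleCat.{u} R),
        Xs 0 = X ∧ memP1 (Xs n) ∧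
        ∀ t : ℕ, t < n → ∃ (Pt : DerivedCategory (ModuleCat.{u} R)) (_ : memP1 Pt)
          (f : Xs (t+1) ⟶ Pt) (g : Pt ⟶ Xs t) (h : Xs t ⟶ (Xs (t+1))⟦(1:ℤ)⟧),
          GhostTriangle f g h by
      intro hX
      obtain ⟨Xs, h0, h1⟩ := h hX
      exact ⟨Xs, ⟨eqToIso h0⟩, h1⟩
    intro hX
    induction n generalizing X with
    | zero => exact ⟨fun _ => X, rfl, hX, fun t ht => absurd ht (Nat.not_lt_zero t)⟩
    | succ n ih =>
      obtain ⟨K, E, hE, f, g, h, hG, hK⟩ := hX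
      obtain ⟨Xs, rfl, h1, h2⟩ := ih K hK
      refine ⟨fun t => Nat.casesOn t X Xs, rfl, h1, fun t ht => ?_⟩
      cases t with
      | zero => exact ⟨E, hE, f, g, h, hG⟩
      | succ t => exact h2 t (by lia)
  · rintro ⟨Xs, ⟨e⟩, h1, h2⟩
    refine xiPdLE_of_iso e ?_
    clear e
    induction n generalizing Xs with
    | zero => exact h1
    | succ n ih =>
      obtain ⟨E, hE, f, g, h, hG⟩ := h2 0 (by lia)
      exact ⟨Xs 1, E, hE, f, g, h, hG, ih (fun t => Xs (t + 1)) h1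
        fun t ht => h2 (t + 1) (by lia)⟩

theorem gammaMap_comp {X Y : DerivedCategory (ModuleCat.{u} R)} (f : X ⟶ Y)
    (N : ModuleCat.{u} R) (s : ℤ) (g : Y ⟶ (stalk N)⟦s⟧) :
    gammaMap X N s (f ≫ g) =
      (homologyFunctor (ModuleCat.{u} R) (-s)).map f ≫ gammaMap Y N s g := by
  simp only [gammaMap, Functor.map_comp, Category.assoc]

theorem gammaMap_zero (X : DerivedCategory (ModuleCat.{u} R)) (N : ModuleCat.{u} R) (s : ℤ) :
    gammaMap X N s 0 = 0 := by
  simp only [gammaMap, Functor.map_zero, zero_comp]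

theorem gammaMap_sub (X : DerivedCategory (ModuleCat.{u} R)) (N : ModuleCat.{u} R) (s : ℤ)
    (f g : X ⟶ (stalk N)⟦s⟧) :
    gammaMap X N s (f - g) = gammaMap X N s f - gammaMap X N s g := by
  simp only [gammaMap, Functor.map_sub, Preadditive.sub_comp]

theorem isZero_homology_stalk_shift (N : ModuleCat.{u} R) (s i : ℤ) (h : i ≠ -s) :
    IsZero ((homologyFunctor (ModuleCat.{u} R) i).obj ((stalk N)⟦s⟧)) := by
  refine IsZero.of_iso ?_ (shiftHomologyIso (stalk N) s i (s + i) rfl)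
  refine IsZero.of_iso ?_ (homologyQIso _ _)
  exact ((HomologicalComplex.exactAt_iff_isZero_homology _ _).1
    (HomologicalComplex.exactAt_single_obj (ComplexShape.up ℤ) 0 N (s + i) (by lia)))

theorem memP1.gammaMap_bijective {E : DerivedCategory (ModuleCat.{u} R)} (hE : memP1 E)
    (N : ModuleCat.{u} R) (s : ℤ) : Function.Bijective (gammaMap E N s) := by
  let c := shiftHomologyIso (stalk N) s (-s) 0 (by ring) ≪≫ stalkHomologyIso N
  have hc (f : E ⟶ (stalk N)⟦s⟧) :
      gammaMap E N s f = (homologyFunctor (ModuleCat.{u} R) (-s)).map f ≫ c.hom := rfl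
  have hE' := hE.isHomologyFree ((stalk N)⟦s⟧)
  constructor
  · intro f g hfg
    refine hE'.1 (funext fun i => ?_)
    by_cases hi : i = -s
    · subst hi
      rwa [hc, hc, cancel_mono] at hfg
    · exact (isZero_homology_stalk_shift N s i hi).eq_of_tgt _ _
  · intro φ
    obtain ⟨f, hf⟩ := hE'.2 fun i => if h : i = -s then
      eqToHom (by rw [h]) ≫ φ ≫ c.inv ≫ eqToHom (by rw [h]) else 0
    refine ⟨f, ?_⟩
    have := congr_fun hf (-s)
    dsimp only at this
    rw [dif_pos rfl] at this
    rw [hc, this]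
    simp

theorem GhostTriangle.gammaMap_bijective [HasExt.{w} (ModuleCat.{u} R)]
    {K E X : DerivedCategory (ModuleCat.{u} R)}
    {f : K ⟶ E} {g : E ⟶ X} {h : X ⟶ K⟦(1 : ℤ)⟧} (hT : GhostTriangle f g h)
    (N : ModuleCat.{u} R)
    (hN : ∀ i, Ext1Zero ((homologyFunctor (ModuleCat.{u} R) i).obj X) N)
    (hK : ∀ s, Function.Bijective (gammaMap K N s))
    (hE : ∀ s, Function.Bijective (gammaMap E N s)) (s : ℤ) :
    Function.Bijective (gammaMap X N s) := by
  constructor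
  · intro a b hab
    rw [← sub_eq_zero] at hab ⊢
    rw [← gammaMap_sub] at hab
    generalize a - b = q at hab ⊢
    have hq : g ≫ q = 0 := (hE s).1 (by rw [gammaMap_comp, hab, comp_zero, gammaMap_zero])
    obtain ⟨r, hr⟩ : ∃ r : K⟦(1 : ℤ)⟧ ⟶ (stalk N)⟦s⟧, q = h ≫ r :=
      Triangle.yoneda_exact₃ _ hT.1 q hq
    let c : (stalk N)⟦s - 1⟧⟦(1 : ℤ)⟧ ≅ (stalk N)⟦s⟧ :=
      ((shiftFunctorAdd' _ (s - 1) 1 s (by lia)).app (stalk N)).symm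
    obtain ⟨k, hk⟩ := (shiftFunctor (DerivedCategory (ModuleCat.{u} R)) (1 : ℤ)).map_surjective
      (r ≫ c.inv)
    obtain ⟨b, hb⟩ := (hT.isSES (-(s - 1))).exists_extension (hN _) (gammaMap K N (s - 1) k)
    obtain ⟨p, rfl⟩ := (hE (s - 1)).2 b
    have hp : f ≫ p = k := (hK (s - 1)).1 (by rw [gammaMap_comp, hb])
    have hhf : h ≫ f⟦(1 : ℤ)⟧' = 0 := comp_distTriang_mor_zero₃₁ _ hT.1
    rw [hr, ← cancel_mono c.inv, zero_comp, Category.assoc, ← hk, ← hp, Functor.map_comp,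
      reassoc_of% hhf, zero_comp]
  · intro φ
    obtain ⟨w, hS⟩ := (hT.isSES (-s)).shortExact
    obtain ⟨q, hq⟩ := (hE s).2 ((homologyFunctor (ModuleCat.{u} R) (-s)).map g ≫ φ)
    have hfq : f ≫ q = 0 := (hK s).1 (by
      rw [gammaMap_comp, hq, reassoc_of% w, zero_comp, gammaMap_zero])
    obtain ⟨r, hr⟩ : ∃ r : X ⟶ (stalk N)⟦s⟧, q = g ≫ r :=
      Triangle.yoneda_exact₂ _ hT.1 q hfq
    refine ⟨r, ?_⟩
    have : Epi ((homologyFunctor (ModuleCat.{u} R) (-s)).map g) := hS.epi_g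
    subst hr
    rw [gammaMap_comp, cancel_epi] at hq
    exact hq

theorem xiPdLE.gammaMap_bijective [HasExt.{w} (ModuleCat.{u} R)] {n : ℕ}
    {X : DerivedCategory (ModuleCat.{u} R)} (hX : xiPdLE n X) (N : ModuleCat.{u} R)
    (hN : ∀ L : ModuleCat.{u} R, pdLE n L → Ext1Zero L N) (s : ℤ) :
    Function.Bijective (gammaMap X N s) := by
  induction n generalizing X s with
  | zero => exact memP1.gammaMap_bijective hX N s
  | succ n ih =>
    have hX' := pdLE_homology_of_xiPdLE (n + 1) X hX
    obtain ⟨K, E, hE, f, g, h, hG, hK⟩ := hX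
    exact hG.gammaMap_bijective N (fun i => hN _ (hX' i))
      (fun s => ih hK (fun L hL => hN L (pdLE_succ hL)) s) (hE.gammaMap_bijective N) s

theorem stmt7 [HasExt.{w} (ModuleCat.{u} R)]
    (n : ℕ) (X : DerivedCategory (ModuleCat.{u} R)) :
    (∃ Xs : ℕ → DerivedCategory (ModuleCat.{u} R),
      Nonempty (Xs 0 ≅ X) ∧ memP1 (Xs n) ∧
      ∀ t : ℕ, t < n → ∃ (Pt : DerivedCategory (ModuleCat.{u} R)) (_ : memP1 Pt)
        (f : Xs (t+1) ⟶ Pt) (g : Pt ⟶ Xs t) (h : Xs t ⟶ (Xs (t+1))⟦(1:ℤ)⟧),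
        GhostTriangle f g h) ↔
    ((∀ s : ℤ, pdLE n ((homologyFunctor (ModuleCat.{u} R) s).obj X)) ∧
      ∀ N : ModuleCat.{u} R,
        (∀ L : ModuleCat.{u} R, pdLE n L → Ext1Zero L N) →
        ∀ s : ℤ, Function.Bijective (gammaMap X N s)) := by
  rw [← xiPdLE_iff_exists_sequence]
  exact ⟨fun h => ⟨pdLE_homology_of_xiPdLE n X h, fun N hN s => h.gammaMap_bijective N hN s⟩,
    fun h => xiPdLE_of_pdLE_homology n X h.1⟩
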